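/- arXiv:2008.02379 — 4 statements merged into one kernel-verified Lean document; each statement's English description precedes it below -/
import Mathlib

section
/- Let t0 < tf be real numbers and p0, v0, pf ∈ ℝ. Let c : ℝ → ℝ be a cubic polynomial satisfying c(t0) = p0, c'(t0) = v0, c(tf) = pf, and c''(tf) = 0. Then for every function f : ℝ → ℝ that is twice continuously differentiable on [t0, tf] with f(t0) = p0, f'(t0) = v0, f(tf) = pf (the terminal speed being free), one has ∫_{t0}^{tf} c''(t)² dt ≤ ∫_{t0}^{tf} f''(t)² dt. -/
open Set intervalIntegral in
/-- Integration by parts twice on `[a, b]`, against an affine weight `q` of slope `k`, with all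
boundary terms vanishing. -/
theorem integral_affine_mul_second_deriv_eq_zero {a b k : ℝ} (hab : a ≤ b)
    {g g' g'' q : ℝ → ℝ} (hq : ∀ t, HasDerivAt q k t)
    (hg : ContinuousOn g (Icc a b)) (hg' : ContinuousOn g' (Icc a b))
    (hg'' : ContinuousOn g'' (Icc a b))
    (hd : ∀ t ∈ Ioo a b, HasDerivAt g (g' t) t) (hd' : ∀ t ∈ Ioo a b, HasDerivAt g' (g'' t) t)
    (hga : g a = 0) (hg'a : g' a = 0) (hgb : g b = 0) (hqb : q b = 0) :
    ∫ t in a..b, q t * g'' t = 0 := by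
  have hqc : Continuous q := continuous_iff_continuousAt.2 fun t => (hq t).continuousAt
  have hFTC := integral_eq_sub_of_hasDerivAt_of_le (f := fun t => q t * g' t - k * g t)
    (f' := fun t => q t * g'' t) hab
    ((hqc.continuousOn.mul hg').sub (continuousOn_const.mul hg))
    (fun t ht => (((hq t).mul (hd' t ht)).sub ((hd t ht).const_mul k)).congr_deriv (by ring))
    ((hqc.continuousOn.mul hg'').intervalIntegrable_of_Icc hab)
  simpa [hga, hg'a, hgb, hqb] using hFTC

open Set in
/-- On the interior of the interval, `derivWithin` is an honest derivative. -/
theorem DifferentiableOn.hasDerivAt_derivWithin_Icc {a b : ℝ} {f : ℝ → ℝ}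
    (hf : DifferentiableOn ℝ f (Icc a b)) {t : ℝ} (ht : t ∈ Ioo a b) :
    HasDerivAt f (derivWithin f (Icc a b) t) t :=
  (hf t (Ioo_subset_Icc_self ht)).hasDerivWithinAt.hasDerivAt (Icc_mem_nhds ht.1 ht.2)

/-- With free terminal speed, the energy-minimizing trajectory with prescribed
initial position/speed and terminal position is a cubic whose control vanishes
at the terminal time. -/
theorem cubic_minimizes_energy_free_terminal_speed
    (t0 tf p0 v0 pf : ℝ) (ht : t0 < tf)
    (P : Polynomial ℝ) (hdeg : P.degree ≤ 3)
    (c : ℝ → ℝ) (hcP : ∀ t, c t = P.eval t)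
    (hc0 : c t0 = p0) (hc0' : deriv c t0 = v0)
    (hcf : c tf = pf) (hcf'' : deriv (deriv c) tf = 0) :
    ∀ f : ℝ → ℝ, ContDiffOn ℝ 2 f (Set.Icc t0 tf) →
      f t0 = p0 → derivWithin f (Set.Icc t0 tf) t0 = v0 →
      f tf = pf →
      (∫ t in t0..tf, (deriv (deriv c) t) ^ 2) ≤
        ∫ t in t0..tf,
          (derivWithin (derivWithin f (Set.Icc t0 tf)) (Set.Icc t0 tf) t) ^ 2 := by
  intro f hf hf0 hf0' hff
  obtain rfl : c = fun t => P.eval t := funext hcP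
  have hderiv (Q : Polynomial ℝ) : (deriv fun t => Q.eval t) = fun t => Q.derivative.eval t :=
    funext fun t => Q.deriv
  simp only [hderiv] at hc0 hc0' hcf hcf'' ⊢
  set s := Set.Icc t0 tf
  set f' := derivWithin f s
  set f'' := derivWithin f' s
  set R := P.derivative.derivative
  have hs : UniqueDiffOn ℝ s := uniqueDiffOn_Icc ht
  have hf' : ContDiffOn ℝ 1 f' s := hf.derivWithin hs (by norm_num)
  have hf'' : ContinuousOn f'' s := hf'.continuousOn_derivWithin hs le_rfl
  have hR : R.derivative.natDegree = 0 := by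
    have h₀ : P.natDegree ≤ 3 := Polynomial.natDegree_le_of_degree_le hdeg
    have h₁ := P.natDegree_derivative_le
    have h₂ := P.derivative.natDegree_derivative_le
    have h₃ := R.natDegree_derivative_le
    lia
  have hRd (t : ℝ) : HasDerivAt (fun t => R.eval t) (R.derivative.coeff 0) t := by
    have h := R.hasDerivAt t
    rwa [Polynomial.eq_C_of_natDegree_eq_zero hR, Polynomial.eval_C] at h
  have hzero : ∫ t in t0..tf, R.eval t * (f'' t - R.eval t) = 0 :=
    integral_affine_mul_second_deriv_eq_zero ht.le hRd
      (g := fun t => f t - P.eval t) (g' := fun t => f' t - P.derivative.eval t)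
      (hf.continuousOn.sub P.continuousOn) (hf'.continuousOn.sub P.derivative.continuousOn)
      (hf''.sub R.continuousOn)
      (fun t h => ((hf.differentiableOn (by norm_num)).hasDerivAt_derivWithin_Icc h).sub
        (P.hasDerivAt t))
      (fun t h => ((hf'.differentiableOn (by norm_num)).hasDerivAt_derivWithin_Icc h).sub
        (P.derivative.hasDerivAt t))
      (by simp [hf0, hc0]) (by simp [hf0', hc0']) (by simp [hff, hcf]) hcf''
  have hRi : IntervalIntegrable (fun t => R.eval t ^ 2) MeasureTheory.volume t0 tf :=
    (R.continuous.pow 2).intervalIntegrable _ _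
  have hcross : IntervalIntegrable (fun t => 2 * (R.eval t * (f'' t - R.eval t)))
      MeasureTheory.volume t0 tf :=
    (continuousOn_const.mul (R.continuousOn.mul
      (hf''.sub R.continuousOn))).intervalIntegrable_of_Icc ht.le
  calc ∫ t in t0..tf, R.eval t ^ 2
      = ∫ t in t0..tf, (R.eval t ^ 2 + 2 * (R.eval t * (f'' t - R.eval t))) := by
        rw [intervalIntegral.integral_add hRi hcross, intervalIntegral.integral_const_mul, hzero,
          mul_zero, add_zero]
    _ ≤ ∫ t in t0..tf, f'' t ^ 2 :=
        intervalIntegral.integral_mono_on ht.le (hRi.add hcross)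
          ((hf''.pow 2).intervalIntegrable_of_Icc ht.le)
          fun t _ => by nlinarith [sq_nonneg (f'' t - R.eval t)]
end

section
/- Let t0 < t1 < ... < tm be real numbers (m ≥ 1), p0, v0 ∈ ℝ, and P1, ..., Pm ∈ ℝ. Suppose s : ℝ → ℝ is twice continuously differentiable on [t0, tm], coincides on each subinterval [t_{j-1}, t_j] (j = 1, ..., m) with a cubic polynomial (equivalently, s'' is continuous on [t0, tm] and affine in t on each subinterval), and satisfies s(t0) = p0, s'(t0) = v0, s(tj) = Pj for j = 1, ..., m, and s''(tm) = 0. Then for every f : ℝ → ℝ that is twice continuously differentiable on [t0, tm] with f(t0) = p0, f'(t0) = v0 and f(tj) = Pj for j = 1, ..., m, one has ∫_{t0}^{tm} s''(t)² dt ≤ ∫_{t0}^{tm} f''(t)² dt. In particular, the energy-optimal control u* = s'' is a continuous piecewise linear function of time. -/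
open Set intervalIntegral in
/-- Integration by parts twice against a polynomial control of degree at most one,
over an interval at whose endpoints the position perturbation `g` vanishes. -/
theorem integral_affine_mul_second_deriv {a b : ℝ} (hab : a ≤ b) {g g₁ g₂ : ℝ → ℝ} (c d : ℝ)
    (hg : ContinuousOn g (Icc a b)) (hg₁ : ContinuousOn g₁ (Icc a b))
    (hg₂ : ContinuousOn g₂ (Icc a b))
    (hd : ∀ x ∈ Ioo a b, HasDerivAt g (g₁ x) x) (hd₁ : ∀ x ∈ Ioo a b, HasDerivAt g₁ (g₂ x) x)
    (ha : g a = 0) (hb : g b = 0) :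
    ∫ x in a..b, (c * x + d) * g₂ x = (c * b + d) * g₁ b - (c * a + d) * g₁ a := by
  have key := integral_eq_sub_of_hasDerivAt_of_le
    (f := fun x => (c * x + d) * g₁ x - c * g x) (f' := fun x => (c * x + d) * g₂ x) hab
    (by fun_prop) (fun x hx => by
      have h := (((hasDerivAt_id x).const_mul c).add_const d).mul (hd₁ x hx)
      refine (h.sub ((hd x hx).const_mul c)).congr_deriv ?_
      simp only [id]
      ring)
    (ContinuousOn.intervalIntegrable_of_Icc hab (by fun_prop))
  simpa [ha, hb] using key

open Set in
/-- The second derivative of a `C²` function that is a cubic polynomial on a subinterval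
is affine on that (closed) subinterval. -/
theorem exists_affine_second_derivWithin {a b u v : ℝ} (huv : u < v)
    (hsub : Icc u v ⊆ Icc a b) {s : ℝ → ℝ}
    (hcont : ContinuousOn (derivWithin (derivWithin s (Icc a b)) (Icc a b)) (Icc a b))
    {Q : Polynomial ℝ} (hQ : Q.degree ≤ 3) (hsQ : ∀ x ∈ Icc u v, s x = Q.eval x) :
    ∃ c d : ℝ, ∀ x ∈ Icc u v,
      derivWithin (derivWithin s (Icc a b)) (Icc a b) x = c * x + d := by
  have hI : ∀ x ∈ Ioo u v, Icc a b ∈ nhds x := fun x hx =>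
    Filter.mem_of_superset (Icc_mem_nhds hx.1 hx.2) hsub
  have h₁ : ∀ x ∈ Ioo u v, derivWithin s (Icc a b) x = Q.derivative.eval x := fun x hx => by
    rw [derivWithin_of_mem_nhds (hI x hx), ← Q.deriv]
    exact Filter.EventuallyEq.deriv_eq
      (Filter.eventually_of_mem (Icc_mem_nhds hx.1 hx.2) hsQ)
  have h₂ : ∀ x ∈ Ioo u v, derivWithin (derivWithin s (Icc a b)) (Icc a b) x
      = Q.derivative.derivative.eval x := fun x hx => by
    rw [derivWithin_of_mem_nhds (hI x hx), ← Polynomial.deriv]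
    exact Filter.EventuallyEq.deriv_eq
      (Filter.eventually_of_mem (Ioo_mem_nhds hx.1 hx.2) h₁)
  have h₃ : ∀ x ∈ Icc u v, derivWithin (derivWithin s (Icc a b)) (Icc a b) x
      = Q.derivative.derivative.eval x :=
    EqOn.of_subset_closure (s := Ioo u v) h₂ (hcont.mono hsub)
      (Polynomial.continuous _).continuousOn Ioo_subset_Icc_self (closure_Ioo huv.ne).ge
  have hdeg : Q.derivative.derivative.natDegree ≤ 1 := by
    have h0 : Q.natDegree ≤ 3 := Polynomial.natDegree_le_of_degree_le hQ
    have h1 := Q.natDegree_derivative_le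
    have h2 := Q.derivative.natDegree_derivative_le
    omega
  obtain ⟨c, d, hcd⟩ := Polynomial.exists_eq_X_add_C_of_natDegree_le_one hdeg
  exact ⟨c, d, fun x hx => by rw [h₃ x hx, hcd]; simp⟩

open Set in
/-- First and second derivatives of a `C²` function on a closed interval: continuity up to the
boundary and two-sided derivatives in the interior. -/
theorem ContDiffOn.derivWithin_Icc_two {a b : ℝ} (hab : a < b) {f : ℝ → ℝ}
    (hf : ContDiffOn ℝ 2 f (Icc a b)) :
    ContinuousOn (derivWithin f (Icc a b)) (Icc a b) ∧
    ContinuousOn (derivWithin (derivWithin f (Icc a b)) (Icc a b)) (Icc a b) ∧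
    (∀ x ∈ Ioo a b, HasDerivAt f (derivWithin f (Icc a b) x) x) ∧
    ∀ x ∈ Ioo a b, HasDerivAt (derivWithin f (Icc a b))
      (derivWithin (derivWithin f (Icc a b)) (Icc a b) x) x := by
  have hu := uniqueDiffOn_Icc hab
  have h₁ : ContDiffOn ℝ 1 (derivWithin f (Icc a b)) (Icc a b) :=
    hf.derivWithin hu (by norm_num)
  refine ⟨h₁.continuousOn, h₁.continuousOn_derivWithin hu le_rfl, fun x hx => ?_, fun x hx => ?_⟩
  · exact ((hf.differentiableOn (by norm_num) x
      (Ioo_subset_Icc_self hx)).hasDerivWithinAt).hasDerivAt (Icc_mem_nhds hx.1 hx.2)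
  · exact ((h₁.differentiableOn (by norm_num) x
      (Ioo_subset_Icc_self hx)).hasDerivWithinAt).hasDerivAt (Icc_mem_nhds hx.1 hx.2)

/-- Theorem 2: the unconstrained solution of the control-effort minimization
problem with interior-point (position) constraints is the piecewise-cubic C²
spline with zero terminal control: it minimizes `∫ s''²` among all C²
trajectories satisfying the same initial and interior-point constraints. -/
theorem spline_minimizes_energy_interior_points
    (m : ℕ) (hm : 1 ≤ m)
    (t : Fin (m + 1) → ℝ) (ht : StrictMono t)
    (p0 v0 : ℝ) (P : Fin m → ℝ)
    (s : ℝ → ℝ)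
    (hs : ContDiffOn ℝ 2 s (Set.Icc (t 0) (t (Fin.last m))))
    (hpiece : ∀ j : Fin m, ∃ Q : Polynomial ℝ, Q.degree ≤ 3 ∧
      ∀ x ∈ Set.Icc (t j.castSucc) (t j.succ), s x = Q.eval x)
    (hs0 : s (t 0) = p0)
    (hs0' : derivWithin s (Set.Icc (t 0) (t (Fin.last m))) (t 0) = v0)
    (hsP : ∀ j : Fin m, s (t j.succ) = P j)
    (hsend : derivWithin (derivWithin s (Set.Icc (t 0) (t (Fin.last m))))
        (Set.Icc (t 0) (t (Fin.last m))) (t (Fin.last m)) = 0) :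
    ∀ f : ℝ → ℝ, ContDiffOn ℝ 2 f (Set.Icc (t 0) (t (Fin.last m))) →
      f (t 0) = p0 →
      derivWithin f (Set.Icc (t 0) (t (Fin.last m))) (t 0) = v0 →
      (∀ j : Fin m, f (t j.succ) = P j) →
      (∫ x in (t 0)..(t (Fin.last m)),
          (derivWithin (derivWithin s (Set.Icc (t 0) (t (Fin.last m))))
            (Set.Icc (t 0) (t (Fin.last m))) x) ^ 2) ≤
        ∫ x in (t 0)..(t (Fin.last m)),
          (derivWithin (derivWithin f (Set.Icc (t 0) (t (Fin.last m))))
            (Set.Icc (t 0) (t (Fin.last m))) x) ^ 2 := by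
  intro f hf hf0 hf0' hfP
  have hab : t 0 < t (Fin.last m) := ht (Fin.lt_def.2 (by simp; omega))
  obtain ⟨cs₁, cs₂, ds, ds₁⟩ := hs.derivWithin_Icc_two hab
  obtain ⟨cf₁, cf₂, df, df₁⟩ := hf.derivWithin_Icc_two hab
  have cs := hs.continuousOn
  have cf := hf.continuousOn
  have haff : ∀ j : Fin m, ∃ c d : ℝ, ∀ x ∈ Set.Icc (t j.castSucc) (t j.succ),
      derivWithin (derivWithin s (Set.Icc (t 0) (t (Fin.last m))))
        (Set.Icc (t 0) (t (Fin.last m))) x = c * x + d := fun j => by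
    obtain ⟨Q, hQ, hsQ⟩ := hpiece j
    exact exists_affine_second_derivWithin (ht j.castSucc_lt_succ)
      (Set.Icc_subset_Icc (ht.monotone (Fin.zero_le _)) (ht.monotone (Fin.le_last _)))
      cs₂ hQ hsQ
  generalize derivWithin (derivWithin s (Set.Icc (t 0) (t (Fin.last m))))
    (Set.Icc (t 0) (t (Fin.last m))) = s₂ at *
  generalize derivWithin (derivWithin f (Set.Icc (t 0) (t (Fin.last m))))
    (Set.Icc (t 0) (t (Fin.last m))) = f₂ at *
  generalize derivWithin s (Set.Icc (t 0) (t (Fin.last m))) = s₁ at *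
  generalize derivWithin f (Set.Icc (t 0) (t (Fin.last m))) = f₁ at *
  have hknot : ∀ i, f (t i) - s (t i) = 0 := fun i => by
    refine Fin.cases ?_ (fun j => ?_) i
    · rw [hf0, hs0, sub_self]
    · rw [hfP, hsP, sub_self]
  have hcross : ∀ i, ∫ x in (t 0)..(t i), s₂ x * (f₂ x - s₂ x)
      = s₂ (t i) * (f₁ (t i) - s₁ (t i)) := fun i => by
    induction i using Fin.induction with
    | zero => simp [hf0', hs0']
    | succ j ih =>
      have h0 := ht.monotone (Fin.zero_le j.castSucc)
      have h1 : t j.castSucc < t j.succ := ht j.castSucc_lt_succ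
      have h2 := ht.monotone (Fin.le_last j.succ)
      have hIcc := Set.Icc_subset_Icc h0 h2
      have hIoo := Set.Ioo_subset_Ioo h0 h2
      have hcont : ContinuousOn (fun x => s₂ x * (f₂ x - s₂ x))
        (Set.Icc (t 0) (t (Fin.last m))) := by fun_prop
      obtain ⟨c, d, hcd⟩ := haff j
      have hpart : ∫ x in (t j.castSucc)..(t j.succ), s₂ x * (f₂ x - s₂ x)
          = ∫ x in (t j.castSucc)..(t j.succ), (c * x + d) * (f₂ x - s₂ x) :=
        intervalIntegral.integral_congr fun x hx => by
          rw [Set.uIcc_of_le h1.le] at hx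
          simp only [hcd x hx]
      rw [← intervalIntegral.integral_add_adjacent_intervals
        ((hcont.mono (Set.Icc_subset_Icc_right (h1.le.trans h2))).intervalIntegrable_of_Icc h0)
        ((hcont.mono hIcc).intervalIntegrable_of_Icc h1.le), ih, hpart,
        integral_affine_mul_second_deriv (g := fun x => f x - s x) (g₁ := fun x => f₁ x - s₁ x)
          (g₂ := fun x => f₂ x - s₂ x)
          h1.le c d ((cf.sub cs).mono hIcc) ((cf₁.sub cs₁).mono hIcc) ((cf₂.sub cs₂).mono hIcc)
          (fun x hx => (df x (hIoo hx)).sub (ds x (hIoo hx)))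
          (fun x hx => (df₁ x (hIoo hx)).sub (ds₁ x (hIoo hx))) (hknot _) (hknot _),
        hcd _ (Set.left_mem_Icc.2 h1.le), hcd _ (Set.right_mem_Icc.2 h1.le)]
      ring
  have hzero : ∫ x in (t 0)..(t (Fin.last m)), s₂ x * (f₂ x - s₂ x) = 0 := by
    rw [hcross, hsend, zero_mul]
  have hint : ∀ {h : ℝ → ℝ}, ContinuousOn h (Set.Icc (t 0) (t (Fin.last m))) →
      IntervalIntegrable h MeasureTheory.volume (t 0) (t (Fin.last m)) :=
    fun hh => hh.intervalIntegrable_of_Icc hab.le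
  calc ∫ x in (t 0)..(t (Fin.last m)), s₂ x ^ 2
      = ∫ x in (t 0)..(t (Fin.last m)), (s₂ x ^ 2 + 2 * (s₂ x * (f₂ x - s₂ x))) := by
        rw [intervalIntegral.integral_add (hint (by fun_prop)) (hint (by fun_prop)),
          intervalIntegral.integral_const_mul, hzero, mul_zero, add_zero]
    _ ≤ ∫ x in (t 0)..(t (Fin.last m)), f₂ x ^ 2 :=
        intervalIntegral.integral_mono_on hab.le (hint (by fun_prop)) (hint (by fun_prop))
          fun x _ => by nlinarith [sq_nonneg (f₂ x - s₂ x)]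
end

section
/- Let lb ∈ ℝ, Δ ≥ 0, and let ℓ be a finite list of pairs (a, b) ∈ ℝ × ℝ with a ≤ b for every pair, sorted in nondecreasing order of the first component a. Define the update step(t, (a, b)) = t if b ≤ t; = t if t + Δ ≤ a; = b otherwise; and let t* be the left fold of step over ℓ starting from lb. Call a time t feasible if t ≥ lb and for every pair (a, b) in ℓ, either b ≤ t or t + Δ ≤ a. Then t* is feasible, and t* ≤ t for every feasible t; i.e., t* is the least feasible time. -/
/-- Theorem 1 (correctness of Algorithm 1): folding the conflict-resolution
step over the sorted list of occupancy intervals returns the least feasible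
arrival time, i.e. the least `t ≥ lb` whose occupancy interval `[t, t + Δ]`
avoids every scheduled interval `[a, b]` in the list. -/
theorem algorithm1_least_feasible_time
    (lb Δ : ℝ) (hΔ : 0 ≤ Δ) (ℓ : List (ℝ × ℝ))
    (hab : ∀ ab ∈ ℓ, ab.1 ≤ ab.2)
    (hsorted : ℓ.Pairwise (fun ab cd => ab.1 ≤ cd.1)) :
    let step : ℝ → ℝ × ℝ → ℝ := fun t ab =>
      if ab.2 ≤ t then t else if t + Δ ≤ ab.1 then t else ab.2
    let tstar : ℝ := ℓ.foldl step lb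
    let Feasible : ℝ → Prop := fun t =>
      lb ≤ t ∧ ∀ ab ∈ ℓ, ab.2 ≤ t ∨ t + Δ ≤ ab.1
    Feasible tstar ∧ ∀ t : ℝ, Feasible t → tstar ≤ t := by
  intro step tstar Feasible
  clear hΔ hab
  induction ℓ generalizing lb with
  | nil => simp [tstar, Feasible]
  | cons x xs ih =>
    obtain ⟨hx, hxs⟩ := List.pairwise_cons.mp hsorted
    obtain ⟨⟨hle, hfeas⟩, hmin⟩ := ih (step lb x) hxs
    have hfold : tstar = xs.foldl step (step lb x) := rfl
    rw [← hfold] at hle hfeas hmin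
    have hlb : lb ≤ step lb x := by
      simp only [step]
      split_ifs <;> linarith
    refine ⟨⟨hlb.trans hle, List.forall_mem_cons.mpr ⟨?_, hfeas⟩⟩, ?_⟩
    · by_cases hb : x.2 ≤ step lb x
      · exact Or.inl (hb.trans hle)
      · have hstay : step lb x = lb ∧ lb + Δ ≤ x.1 := by
          simp only [step] at hb ⊢
          split_ifs at hb ⊢ with h₁ h₂
          · exact absurd h₁ hb
          · exact ⟨rfl, h₂⟩
          · exact absurd le_rfl hb
        have hupper := hmin lb ⟨hstay.1.le, fun y hy => Or.inr (hstay.2.trans (hx y hy))⟩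
        exact Or.inr (by linarith [hstay.2])
    · rintro t ⟨hlt, ht⟩
      obtain ⟨hhead, htail⟩ := List.forall_mem_cons.mp ht
      refine hmin t ⟨?_, htail⟩
      simp only [step]
      split_ifs
      · exact hlt
      · exact hlt
      · rcases hhead with h | h <;> linarith
end

section
/- Let v_min > 0 and ε ≥ 0. Let p_j, p_j*, p_i, p_i* : ℝ → ℝ satisfy: |p_j(t) − p_j*(t)| ≤ ε and |p_i(t) − p_i*(t)| ≤ ε for all t; p_j(t2) − p_j(t1) ≥ v_min·(t2 − t1) and p_i(t2) − p_i(t1) ≥ v_min·(t2 − t1) for all t1 ≤ t2. Let C_exit, C_arr ∈ ℝ and suppose the nominal trajectories satisfy p_j*(T_j) = C_exit and p_i*(T_i) = C_arr with T_i ≥ T_j + 2ε/v_min (the schedules are separated by the idle time t_idle = 2ε/v_min). If t_j and t_i are actual times with p_j(t_j) = C_exit and p_i(t_i) = C_arr, then t_i ≥ t_j; i.e., CAV i actually arrives at the merging zone no earlier than CAV j actually exits it. -/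
/-- If `p` increases at rate at least `v > 0` and its values at `s` and `t` differ by at most `ε`,
then `s` and `t` differ by at most `ε / v`. -/
theorem abs_sub_le_div_of_rate {v ε : ℝ} (hv : 0 < v) {p : ℝ → ℝ}
    (hrate : ∀ s t : ℝ, s ≤ t → v * (t - s) ≤ p t - p s) {s t : ℝ}
    (h : |p s - p t| ≤ ε) : |s - t| ≤ ε / v := by
  rw [le_div_iff₀' hv]
  obtain ⟨h₁, h₂⟩ := abs_le.mp h
  rcases le_total s t with hst | hst
  · rw [abs_of_nonpos (sub_nonpos.mpr hst)]
    linarith [hrate s t hst]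
  · rw [abs_of_nonneg (sub_nonneg.mpr hst)]
    linarith [hrate t s hst]

/-- Lateral safety with idle time: if the planned schedules are separated by
the idle time `t_idle = 2ε / v_min`, then despite bounded tracking errors the
actual arrival of CAV `i` at the merging zone does not precede the actual exit
of CAV `j`. -/
theorem idle_time_preserves_lateral_safety
    (vmin ε : ℝ) (hv : 0 < vmin) (hε : 0 ≤ ε)
    (pj pjstar pi pistar : ℝ → ℝ)
    (hdevj : ∀ t, |pj t - pjstar t| ≤ ε)
    (hdevi : ∀ t, |pi t - pistar t| ≤ ε)
    (hratej : ∀ t1 t2 : ℝ, t1 ≤ t2 → vmin * (t2 - t1) ≤ pj t2 - pj t1)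
    (hratei : ∀ t1 t2 : ℝ, t1 ≤ t2 → vmin * (t2 - t1) ≤ pi t2 - pi t1)
    (Cexit Carr : ℝ) (Tj Ti : ℝ)
    (hTj : pjstar Tj = Cexit) (hTi : pistar Ti = Carr)
    (hsep : Tj + 2 * ε / vmin ≤ Ti)
    (tj ti : ℝ) (htj : pj tj = Cexit) (hti : pi ti = Carr) :
    tj ≤ ti := by
  have hj : |Tj - tj| ≤ ε / vmin :=
    abs_sub_le_div_of_rate hv hratej (by rw [htj, ← hTj]; exact hdevj Tj)
  have hi : |Ti - ti| ≤ ε / vmin :=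
    abs_sub_le_div_of_rate hv hratei (by rw [hti, ← hTi]; exact hdevi Ti)
  rw [mul_div_assoc] at hsep
  linarith [(abs_le.mp hj).1, (abs_le.mp hi).2]
end
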